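/- Assume m_A ≠ m_C and let M be the 2×3 real matrix M = (1/(m_A − m_C))·[[−2(m_A + m_C), 4, −2b_A], [−4m_A·m_C, 2(m_A + m_C), −2b_A·m_C]]. Then: (i) for every (x, y, w) ∈ ℝ³ and all points (x_A, y_A) on A(w) and (x_C, y_C) on C(w), the point (x, y) is the midpoint of (x_A, y_A) and (x_C, y_C) if and only if (x_A − x_C, y_A − y_C)ᵀ = M·(x, y, w)ᵀ; (ii) the 3×3 matrix MᵀM is positive semidefinite of rank 2; (iii) the AC cylinder equals the quadric {𝐱 ∈ ℝ³ : 𝐱ᵀ(MᵀM)𝐱 = 1/2}. -/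

import Mathlib

noncomputable section

open Real Set

/-- Membership predicate for conformally inscribed parallelograms.
Coordinates of `P : Fin 9 → ℝ`:
`0 = x_A, 1 = y_A, 2 = x_B, 3 = y_B, 4 = x_C, 5 = y_C, 6 = x_D, 7 = y_D, 8 = w`.
The vertex `(x_L, y_L)` lies on the line `L(w)` for `L ∈ {A,B,C,D}` and the
midpoints of the two diagonals coincide. -/
def IsCIP (mA mB mC mD bA : ℝ) (P : Fin 9 → ℝ) : Prop :=
  P 1 = mA * P 0 + bA * P 8 ∧
  P 3 = mB * P 2 + P 8 ∧
  P 5 = mC * P 4 ∧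
  P 7 = mD * P 6 ∧
  P 0 + P 4 = P 2 + P 6 ∧
  P 1 + P 5 = P 3 + P 7

/-- `Π`, the set of conformally inscribed parallelograms. -/
def CIP (mA mB mC mD bA : ℝ) : Set (Fin 9 → ℝ) := {P | IsCIP mA mB mC mD bA P}

/-- The `AC` diagonal vector of a parallelogram. -/
def vAC (P : Fin 9 → ℝ) : ℝ × ℝ := (P 0 - P 4, P 1 - P 5)

/-- The `BD` diagonal vector of a parallelogram. -/
def vBD (P : Fin 9 → ℝ) : ℝ × ℝ := (P 2 - P 6, P 3 - P 7)

/-- The `AB` side vector of a parallelogram. -/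
def vAB (P : Fin 9 → ℝ) : ℝ × ℝ := (P 0 - P 2, P 1 - P 3)

/-- The `BC` side vector of a parallelogram. -/
def vBC (P : Fin 9 → ℝ) : ℝ × ℝ := (P 2 - P 4, P 3 - P 5)

/-- Dot product in `ℝ²`. -/
def dot2 (a b : ℝ × ℝ) : ℝ := a.1 * b.1 + a.2 * b.2

/-- The inner product `⟨P, Q⟩ = P_AC · Q_AC + P_BD · Q_BD` on `Π`. -/
def pinner (P Q : Fin 9 → ℝ) : ℝ := dot2 (vAC P) (vAC Q) + dot2 (vBD P) (vBD Q)

open Matrix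

/-- The `AC` cylinder, as a subset of `ℝ³` with coordinates `(x, y, w) = (v 0, v 1, v 2)`. -/
def ACcylF (mA bA mC : ℝ) : Set (Fin 3 → ℝ) :=
  {v | ∃ xA yA xC yC : ℝ, yA = mA * xA + bA * v 2 ∧ yC = mC * xC ∧
      2 * v 0 = xA + xC ∧ 2 * v 1 = yA + yC ∧
      (xA - xC) ^ 2 + (yA - yC) ^ 2 = 1 / 2}

/-- The matrix sending `(x, y, w)` to the vector from the point of `C(w)` to the point of `A(w)`
with midpoint `(x, y)`. -/
def diagonalMatrix (mA mC bA : ℝ) : Matrix (Fin 2) (Fin 3) ℝ :=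
  (1 / (mA - mC)) •
    !![-2 * (mA + mC), 4, -2 * bA; -4 * mA * mC, 2 * (mA + mC), -2 * bA * mC]

theorem diagonalMatrix_mulVec (mA mC bA x y w : ℝ) :
    (diagonalMatrix mA mC bA).mulVec ![x, y, w] =
      ![(-2 * (mA + mC) * x + 4 * y - 2 * bA * w) / (mA - mC),
        (-4 * mA * mC * x + 2 * (mA + mC) * y - 2 * bA * mC * w) / (mA - mC)] := by
  ext i
  fin_cases i <;>
    simp [diagonalMatrix, Matrix.mulVec, dotProduct, Fin.sum_univ_three] <;> ring

theorem midpoint_iff_diagonalMatrix_mulVec {mA mC bA : ℝ} (hAC : mA ≠ mC)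
    {x y w xA yA xC yC : ℝ} (hA : yA = mA * xA + bA * w) (hC : yC = mC * xC) :
    (2 * x = xA + xC ∧ 2 * y = yA + yC) ↔
      (diagonalMatrix mA mC bA).mulVec ![x, y, w] = ![xA - xC, yA - yC] := by
  have hd : mA - mC ≠ 0 := sub_ne_zero.mpr hAC
  subst hA hC
  rw [diagonalMatrix_mulVec, ← List.ofFn_inj]
  simp only [List.ofFn_succ, List.ofFn_zero, Matrix.cons_val_zero, Matrix.cons_val_succ,
    List.cons.injEq, and_true, div_eq_iff hd]
  constructor
  · rintro ⟨hx, hy⟩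
    constructor
    · linear_combination (-(mA + mC)) * hx + 2 * hy
    · linear_combination (-2 * mA * mC) * hx + (mA + mC) * hy
  · rintro ⟨h₁, h₂⟩
    constructor
    · apply mul_left_cancel₀ (pow_ne_zero 2 hd)
      linear_combination (-(mA + mC)) * h₁ + 2 * h₂
    · apply mul_left_cancel₀ (pow_ne_zero 2 hd)
      linear_combination (-2 * mA * mC) * h₁ + (mA + mC) * h₂

theorem rank_diagonalMatrix {mA mC : ℝ} (hAC : mA ≠ mC) (bA : ℝ) :
    (diagonalMatrix mA mC bA).rank = 2 := by
  have hd : mA - mC ≠ 0 := sub_ne_zero.mpr hAC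
  apply le_antisymm
  · simpa using (diagonalMatrix mA mC bA).rank_le_height
  · have h : diagonalMatrix mA mC bA * ((1 / (2 * (mA - mC))) •
        !![-(mA + mC), 2; -2 * mA * mC, mA + mC; 0, 0]) = 1 := by
      ext i j
      fin_cases i <;> fin_cases j <;>
        simp [diagonalMatrix, Matrix.mul_apply, Fin.sum_univ_three] <;> field_simp <;> ring
    have hle := Matrix.rank_mul_le_left (diagonalMatrix mA mC bA)
      ((1 / (2 * (mA - mC))) • !![-(mA + mC), 2; -2 * mA * mC, mA + mC; 0, 0])
    rw [h, Matrix.rank_one, Fintype.card_fin] at hle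
    exact hle

theorem dotProduct_transpose_mul_self_mulVec {m n : Type*} [Fintype m] [Fintype n]
    (M : Matrix m n ℝ) (v : n → ℝ) :
    v ⬝ᵥ (Mᵀ * M).mulVec v = M.mulVec v ⬝ᵥ M.mulVec v := by
  rw [← Matrix.mulVec_mulVec, Matrix.dotProduct_mulVec, Matrix.vecMul_transpose]

theorem exists_midpoint_eq {mA mC : ℝ} (hAC : mA ≠ mC) (bA x y w : ℝ) :
    ∃ xA yA xC yC : ℝ, yA = mA * xA + bA * w ∧ yC = mC * xC ∧
      2 * x = xA + xC ∧ 2 * y = yA + yC := by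
  have hd : mA - mC ≠ 0 := sub_ne_zero.mpr hAC
  refine ⟨(2 * y - bA * w - 2 * mC * x) / (mA - mC), _,
    (2 * mA * x + bA * w - 2 * y) / (mA - mC), _, rfl, rfl, ?_, ?_⟩ <;> field_simp <;> ring

theorem ACcylF_eq_quadric {mA mC : ℝ} (hAC : mA ≠ mC) (bA : ℝ) :
    ACcylF mA bA mC = {v : Fin 3 → ℝ |
      v ⬝ᵥ ((diagonalMatrix mA mC bA)ᵀ * diagonalMatrix mA mC bA).mulVec v = 1 / 2} := by
  ext v
  have hv : v = ![v 0, v 1, v 2] := by ext i; fin_cases i <;> rfl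
  have key {xA yA xC yC : ℝ} (hA : yA = mA * xA + bA * v 2) (hC : yC = mC * xC)
      (hx : 2 * v 0 = xA + xC) (hy : 2 * v 1 = yA + yC) :
      v ⬝ᵥ ((diagonalMatrix mA mC bA)ᵀ * diagonalMatrix mA mC bA).mulVec v =
        (xA - xC) ^ 2 + (yA - yC) ^ 2 := by
    have h := (midpoint_iff_diagonalMatrix_mulVec hAC hA hC).mp ⟨hx, hy⟩
    rw [← hv] at h
    rw [dotProduct_transpose_mul_self_mulVec, h, Matrix.vec2_dotProduct']
    ring
  constructor
  · rintro ⟨xA, yA, xC, yC, hA, hC, hx, hy, h⟩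
    exact (key hA hC hx hy).trans h
  · intro h
    obtain ⟨xA, yA, xC, yC, hA, hC, hx, hy⟩ := exists_midpoint_eq hAC bA (v 0) (v 1) (v 2)
    exact ⟨xA, yA, xC, yC, hA, hC, hx, hy, (key hA hC hx hy).symm.trans h⟩

theorem stmt_17 (mA mB mC mD bA : ℝ) (hCD : mC ≠ mD) (hAC : mA ≠ mC)
    (M : Matrix (Fin 2) (Fin 3) ℝ)
    (hM : M = (1 / (mA - mC)) •
        !![-2 * (mA + mC), 4, -2 * bA; -4 * mA * mC, 2 * (mA + mC), -2 * bA * mC]) :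
    (∀ x y w xA yA xC yC : ℝ, yA = mA * xA + bA * w → yC = mC * xC →
        ((2 * x = xA + xC ∧ 2 * y = yA + yC) ↔
          M.mulVec ![x, y, w] = ![xA - xC, yA - yC])) ∧
    (Mᵀ * M).PosSemidef ∧
    (Mᵀ * M).rank = 2 ∧
    ACcylF mA bA mC = {v : Fin 3 → ℝ | v ⬝ᵥ (Mᵀ * M).mulVec v = 1 / 2} := by
  obtain rfl : M = diagonalMatrix mA mC bA := hM
  refine ⟨fun x y w xA yA xC yC hA hC => midpoint_iff_diagonalMatrix_mulVec hAC hA hC, ?_, ?_,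
    ACcylF_eq_quadric hAC bA⟩
  · simpa only [Matrix.conjTranspose_eq_transpose_of_trivial] using
      Matrix.posSemidef_conjTranspose_mul_self (diagonalMatrix mA mC bA)
  · rw [Matrix.rank_transpose_mul_self, rank_diagonalMatrix hAC]
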